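/- arXiv:1610.01103 — 7 statements merged into one kernel-verified Lean document; each statement's English description precedes it below -/
import Mathlib

section
/- Let (Ω, 𝓕, P) be a probability space, I a countable index set, (T_i)_{i∈I} a family of invertible measure-preserving transformations of Ω such that every A ∈ 𝓕 with T_i⁻¹A = A for all i ∈ I satisfies P(A) ∈ {0,1}. Let 𝓗 be a separable complex Hilbert space and H : Ω → (bounded self-adjoint operators on 𝓗) be weakly measurable, i.e. for all u, v ∈ 𝓗 the map ω ↦ ⟨H(ω)u, v⟩ is measurable. Suppose there are unitary operators U_i on 𝓗 with H(T_i ω) = U_i H(ω) U_i* for all ω ∈ Ω and i ∈ I. Then there exists a closed set Σ ⊆ ℝ such that spec(H(ω)) = Σ for P-almost every ω. -/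
open MeasureTheory
open scoped ComplexInnerProductSpace

/-- The shifted operator `A - l` is bounded below by `r`. -/
def ShiftBoundedBelow {E : Type*} [NormedAddCommGroup E] [InnerProductSpace ℂ E]
    (A : E →L[ℂ] E) (l r : ℝ) : Prop :=
  ∀ u : E, r * ‖u‖ ≤ ‖A u - (l : ℂ) • u‖

section BoundedBelow

variable {E : Type*} [NormedAddCommGroup E] [InnerProductSpace ℂ E]

theorem ShiftBoundedBelow.shift {A : E →L[ℂ] E} {l r : ℝ} (h : ShiftBoundedBelow A l r) (m : ℝ) :
    ShiftBoundedBelow A m (r - |m - l|) := by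
  intro u
  have h1 : A u - (l : ℂ) • u = (A u - (m : ℂ) • u) + ((m - l : ℝ) : ℂ) • u := by
    push_cast
    module
  have h2 := norm_add_le (A u - (m : ℂ) • u) (((m - l : ℝ) : ℂ) • u)
  rw [← h1, norm_smul, Complex.norm_real, Real.norm_eq_abs] at h2
  linarith [h u]

theorem ShiftBoundedBelow.mono {A : E →L[ℂ] E} {l r s : ℝ} (h : ShiftBoundedBelow A l r)
    (hs : s ≤ r) : ShiftBoundedBelow A l s :=
  fun u => (mul_le_mul_of_nonneg_right hs (norm_nonneg u)).trans (h u)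

theorem algebraMap_sub_apply_eq_neg (A : E →L[ℂ] E) (l : ℝ) (u : E) :
    (algebraMap ℝ (E →L[ℂ] E) l - A) u = -(A u - (l : ℂ) • u) := by
  simp [Algebra.algebraMap_eq_smul_one]

/-- A self-adjoint bounded operator which is bounded below is invertible. -/
theorem IsSelfAdjoint.isUnit_of_antilipschitz [CompleteSpace E] {A : E →L[ℂ] E}
    (hA : IsSelfAdjoint A) {K : NNReal} (h : AntilipschitzWith K A) : IsUnit A := by
  rw [ContinuousLinearMap.isUnit_iff_bijective,
    ContinuousLinearMap.bijective_iff_dense_range_and_antilipschitz]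
  refine ⟨?_, ⟨_, h⟩⟩
  rw [Submodule.topologicalClosure_eq_top_iff,
    ContinuousLinearMap.IsStarNormal.orthogonal_range hA.isStarNormal]
  exact LinearMap.ker_eq_bot.2 h.injective

theorem IsSelfAdjoint.notMem_spectrum_iff [CompleteSpace E] {A : E →L[ℂ] E}
    (hA : IsSelfAdjoint A) (l : ℝ) :
    l ∉ spectrum ℝ A ↔ ∃ c > 0, ShiftBoundedBelow A l c := by
  rw [spectrum.notMem_iff]
  constructor
  · rintro ⟨V, hV⟩
    refine ⟨(‖(↑V⁻¹ : E →L[ℂ] E)‖ + 1)⁻¹, by positivity, fun u => ?_⟩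
    rw [inv_mul_le_iff₀ (by positivity), ← norm_neg (A u - _), ← algebraMap_sub_apply_eq_neg, ← hV]
    have h1 : (↑V⁻¹ : E →L[ℂ] E) ((V : E →L[ℂ] E) u) = u := by
      rw [← mul_apply_eq_comp, Units.inv_mul, one_apply_eq_self]
    have h2 := (↑V⁻¹ : E →L[ℂ] E).le_opNorm ((V : E →L[ℂ] E) u)
    rw [h1] at h2
    linarith [norm_nonneg ((V : E →L[ℂ] E) u)]
  · rintro ⟨c, hc, h⟩
    have hsa : IsSelfAdjoint (algebraMap ℝ (E →L[ℂ] E) l - A) :=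
      (IsSelfAdjoint.algebraMap _ (IsSelfAdjoint.all l)).sub hA
    lift c to NNReal using hc.le
    refine hsa.isUnit_of_antilipschitz (K := c⁻¹)
      (ContinuousLinearMap.antilipschitz_of_bound _ fun u => ?_)
    rw [algebraMap_sub_apply_eq_neg, norm_neg, NNReal.coe_inv,
      ← inv_mul_le_iff₀ (by positivity), inv_inv]
    exact h u

/-- The resolvent set of a self-adjoint operator is exhausted by rational intervals on which the
operator is quantitatively bounded below. -/
theorem IsSelfAdjoint.notMem_spectrum_iff_rat [CompleteSpace E] {A : E →L[ℂ] E}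
    (hA : IsSelfAdjoint A) (l : ℝ) :
    l ∉ spectrum ℝ A ↔ ∃ p : ℚ × ℚ, l ∈ Metric.ball (p.1 : ℝ) p.2 ∧
      ShiftBoundedBelow A p.1 p.2 := by
  rw [hA.notMem_spectrum_iff]
  constructor
  · rintro ⟨c, hc, h⟩
    obtain ⟨q, hq1, hq2⟩ := exists_rat_btwn (show l < l + c / 3 by linarith)
    obtain ⟨r, hr1, hr2⟩ := exists_rat_btwn (show c / 3 < c / 2 by linarith)
    have hql : |(q : ℝ) - l| < c / 3 := by rw [abs_lt]; constructor <;> linarith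
    refine ⟨(q, r), ?_, (h.shift q).mono (by linarith)⟩
    rw [Metric.mem_ball, dist_comm, Real.dist_eq]
    linarith
  · rintro ⟨p, hl, h⟩
    rw [Metric.mem_ball, Real.dist_eq] at hl
    exact ⟨_, sub_pos.2 hl, h.shift l⟩

theorem shiftBoundedBelow_unitary_conj_iff [CompleteSpace E] {V : E →L[ℂ] E}
    (hV : V ∈ unitary (E →L[ℂ] E)) (A : E →L[ℂ] E) (l r : ℝ) :
    ShiftBoundedBelow (V * A * star V) l r ↔ ShiftBoundedBelow A l r := by
  have h1 (u : E) : star V (V u) = u := by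
    rw [← mul_apply_eq_comp, Unitary.star_mul_self_of_mem hV,
      one_apply_eq_self]
  have h2 (u : E) : V (star V u) = u := by
    rw [← mul_apply_eq_comp, Unitary.mul_star_self_of_mem hV,
      one_apply_eq_self]
  have key (u : E) : ‖(V * A * star V) (V u) - (l : ℂ) • V u‖ = ‖A u - (l : ℂ) • u‖ := by
    rw [mul_apply_eq_comp, mul_apply_eq_comp, h1, ← map_smul, ← map_sub,
      ContinuousLinearMap.norm_map_of_mem_unitary hV]
  constructor
  · intro h u
    rw [← key, ← ContinuousLinearMap.norm_map_of_mem_unitary hV u]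
    exact h (V u)
  · intro h u
    have h3 := h (star V u)
    rwa [← key, h2, ← ContinuousLinearMap.norm_map_of_mem_unitary hV (star V u), h2] at h3

end BoundedBelow

theorem norm_le_iff_forall_denseRange_inner {E ι : Type*} [NormedAddCommGroup E]
    [InnerProductSpace ℂ E] {e : ι → E} (he : DenseRange e) {C : ℝ} (hC : 0 ≤ C) (x : E) :
    ‖x‖ ≤ C ↔ ∀ i, ‖⟪x, e i⟫‖ ≤ C * ‖e i‖ := by
  constructor
  · exact fun h i => (norm_inner_le_norm x (e i)).trans (by gcongr)
  · intro h
    have h1 : ‖⟪x, x⟫‖ ≤ C * ‖x‖ :=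
      he.induction_on (p := fun v => ‖⟪x, v⟫‖ ≤ C * ‖v‖) x
        (isClosed_le (by fun_prop) (by fun_prop)) h
    rw [inner_self_eq_norm_sq_to_K, norm_pow, RCLike.norm_ofReal, abs_norm, sq] at h1
    rcases (norm_nonneg x).eq_or_lt with h0 | h0
    · rwa [← h0]
    · exact le_of_mul_le_mul_right h1 h0

/-- The norm of a weakly measurable map into a separable Hilbert space is measurable. -/
theorem measurable_norm_of_measurable_inner {Ω E : Type*} [MeasurableSpace Ω]
    [NormedAddCommGroup E] [InnerProductSpace ℂ E] [TopologicalSpace.SeparableSpace E]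
    {f : Ω → E} (hf : ∀ v, Measurable fun ω => ⟪f ω, v⟫) : Measurable fun ω => ‖f ω‖ := by
  refine measurable_of_Iic fun C => ?_
  rcases lt_or_ge C 0 with hC | hC
  · convert MeasurableSet.empty
    ext ω
    simpa using hC.trans_le (norm_nonneg (f ω))
  · have : (fun ω => ‖f ω‖) ⁻¹' Set.Iic C = ⋂ n, {ω | ‖⟪f ω, TopologicalSpace.denseSeq E n⟫‖ ≤
        C * ‖TopologicalSpace.denseSeq E n‖} := by
      ext ω
      simpa using norm_le_iff_forall_denseRange_inner (TopologicalSpace.denseRange_denseSeq E) hC _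
    rw [this]
    exact MeasurableSet.iInter fun n => measurableSet_le (hf _).norm measurable_const

theorem measurableSet_shiftBoundedBelow {Ω E : Type*} [MeasurableSpace Ω]
    [NormedAddCommGroup E] [InnerProductSpace ℂ E] [TopologicalSpace.SeparableSpace E]
    {A : Ω → E →L[ℂ] E} (hA : ∀ u v : E, Measurable fun ω => ⟪A ω u, v⟫) (l r : ℝ) :
    MeasurableSet {ω | ShiftBoundedBelow (A ω) l r} := by
  have : {ω | ShiftBoundedBelow (A ω) l r} = ⋂ n, {ω | r * ‖TopologicalSpace.denseSeq E n‖ ≤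
      ‖A ω (TopologicalSpace.denseSeq E n) - (l : ℂ) • TopologicalSpace.denseSeq E n‖} := by
    ext ω
    simp only [Set.mem_ofPred_eq, Set.mem_iInter]
    exact ⟨fun h n => h _, fun h u => (TopologicalSpace.denseRange_denseSeq E).induction_on
      (p := fun u => r * ‖u‖ ≤ ‖A ω u - (l : ℂ) • u‖) u
      (isClosed_le (by fun_prop) (by fun_prop)) h⟩
  rw [this]
  refine MeasurableSet.iInter fun n => measurableSet_le measurable_const
    (measurable_norm_of_measurable_inner fun v => ?_)
  simp only [inner_sub_left]
  exact (hA _ v).sub measurable_const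

theorem almost_sure_nonrandom_spectrum
    {Ω : Type*} [MeasurableSpace Ω] (P : Measure Ω) [IsProbabilityMeasure P]
    {I : Type*} [Countable I]
    {𝓗 : Type*} [NormedAddCommGroup 𝓗] [InnerProductSpace ℂ 𝓗] [CompleteSpace 𝓗]
    [TopologicalSpace.SeparableSpace 𝓗]
    (T : I → Ω → Ω)
    (hTbij : ∀ i, Function.Bijective (T i))
    (hTmp : ∀ i, MeasurePreserving (T i) P P)
    (hErg : ∀ A : Set Ω, MeasurableSet A → (∀ i, T i ⁻¹' A = A) → P A = 0 ∨ P A = 1)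
    (Hop : Ω → 𝓗 →L[ℂ] 𝓗)
    (hsa : ∀ ω, IsSelfAdjoint (Hop ω))
    (hmeas : ∀ u v : 𝓗, Measurable fun ω => ⟪Hop ω u, v⟫)
    (U : I → 𝓗 →L[ℂ] 𝓗) (hU : ∀ i, U i ∈ unitary (𝓗 →L[ℂ] 𝓗))
    (hcov : ∀ i ω, Hop (T i ω) = U i * Hop ω * star (U i)) :
    ∃ S : Set ℝ, IsClosed S ∧ ∀ᵐ ω ∂P, spectrum ℝ (Hop ω) = S := by
  let B : ℚ × ℚ → Set Ω := fun p => {ω | ShiftBoundedBelow (Hop ω) p.1 p.2}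
  have hB (p : ℚ × ℚ) : MeasurableSet (B p) := measurableSet_shiftBoundedBelow hmeas _ _
  have hB01 (p : ℚ × ℚ) : P (B p) = 0 ∨ P (B p) = 1 := by
    refine hErg _ (hB p) fun i => ?_
    ext ω
    simp only [B, Set.mem_preimage, Set.mem_ofPred_eq, hcov,
      shiftBoundedBelow_unitary_conj_iff (hU i)]
  have hae : ∀ᵐ ω ∂P, ∀ p, ω ∈ B p ↔ P (B p) = 1 := by
    refine ae_all_iff.2 fun p => ?_
    rcases hB01 p with h | h
    · filter_upwards [measure_eq_zero_iff_ae_notMem.1 h] with ω hω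
      simp [hω, h]
    · filter_upwards [(mem_ae_iff_prob_eq_one (hB p)).2 h] with ω hω
      simp [hω, h]
  refine ⟨(⋃ p ∈ {p | P (B p) = 1}, Metric.ball (p.1 : ℝ) p.2)ᶜ,
    (isOpen_biUnion fun _ _ => Metric.isOpen_ball).isClosed_compl, ?_⟩
  filter_upwards [hae] with ω hω
  ext l
  rw [← not_iff_not, (hsa ω).notMem_spectrum_iff_rat, Set.notMem_compl_iff]
  simp only [Set.mem_iUnion, Set.mem_ofPred_eq, ← hω, B, exists_prop]
  exact exists_congr fun p => and_comm
end

section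
/- Let H be a complex Hilbert space, A and B bounded self-adjoint operators on H, and let δ ∈ [0, 1/2] satisfy ‖Bu‖ ≤ δ(‖Au‖ + ‖u‖) for all u ∈ H. Then spec(A + B) ⊆ { λ ∈ ℝ : dist(λ, spec(A)) ≤ 2δ(|λ| + 1) }. -/
open scoped ComplexInnerProductSpace

namespace IsSelfAdjoint

variable {H : Type*} [NormedAddCommGroup H] [InnerProductSpace ℂ H] [CompleteSpace H]

/-- A self-adjoint operator which is bounded from below is invertible. -/
lemma isUnit_of_forall_mul_norm_le {T : H →L[ℂ] H} (hT : IsSelfAdjoint T) {c : ℝ} (hc : 0 < c)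
    (h : ∀ u, c * ‖u‖ ≤ ‖T u‖) : IsUnit T := by
  have hanti : AntilipschitzWith (Real.toNNReal c⁻¹) T := T.antilipschitz_of_bound fun u ↦ by
    rw [Real.coe_toNNReal _ (inv_nonneg.2 hc.le), inv_mul_eq_div, le_div_iff₀' hc]
    exact h u
  rw [ContinuousLinearMap.isUnit_iff_bijective,
    ContinuousLinearMap.bijective_iff_dense_range_and_antilipschitz]
  refine ⟨?_, _, hanti⟩
  rw [Submodule.topologicalClosure_eq_top_iff,
    ContinuousLinearMap.IsStarNormal.orthogonal_range hT.isStarNormal]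
  exact LinearMap.ker_eq_bot.2 hanti.injective

/-- The resolvent estimate for a self-adjoint operator: `T - x` is bounded from below by the
distance from `x` to the spectrum of `T`. -/
lemma infDist_spectrum_mul_norm_le {T : H →L[ℂ] H} (hT : IsSelfAdjoint T) (x : ℝ) (u : H) :
    Metric.infDist x (spectrum ℝ T) * ‖u‖ ≤ ‖(T - algebraMap ℝ (H →L[ℂ] H) x) u‖ := by
  rcases Metric.infDist_nonneg.eq_or_lt (a := (0 : ℝ)) (b := Metric.infDist x (spectrum ℝ T))
    with hd | hd
  · simp [← hd]
  have hdist : ∀ t ∈ spectrum ℝ T, Metric.infDist x (spectrum ℝ T) ≤ |t - x| := fun t ht ↦ by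
    simpa [Real.dist_eq, abs_sub_comm] using Metric.infDist_le_dist_of_mem (x := x) ht
  have hne : ∀ t ∈ spectrum ℝ T, t - x ≠ 0 := fun t ht ↦
    abs_pos.1 (hd.trans_le (hdist t ht))
  have hcont : ContinuousOn (fun t : ℝ ↦ (t - x)⁻¹) (spectrum ℝ T) :=
    (by fun_prop : ContinuousOn (fun t : ℝ ↦ t - x) _).inv₀ hne
  have hsub : cfc (fun t : ℝ ↦ t - x) T = T - algebraMap ℝ (H →L[ℂ] H) x := by
    rw [cfc_sub (fun t ↦ t) (fun _ ↦ x) T, cfc_id' ℝ T, cfc_const x T]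
  have hinv : cfc (fun t : ℝ ↦ (t - x)⁻¹) T * (T - algebraMap ℝ (H →L[ℂ] H) x) = 1 := by
    rw [← hsub, ← cfc_mul _ _ T hcont, ← cfc_one ℝ T]
    exact cfc_congr fun t ht ↦ inv_mul_cancel₀ (hne t ht)
  have hnorm : ‖cfc (fun t : ℝ ↦ (t - x)⁻¹) T‖ ≤ (Metric.infDist x (spectrum ℝ T))⁻¹ :=
    norm_cfc_le (inv_nonneg.2 hd.le) fun t ht ↦ by
      rw [norm_inv, Real.norm_eq_abs]
      exact inv_anti₀ hd (hdist t ht)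
  rw [← le_div_iff₀' hd, ← inv_mul_eq_div]
  calc ‖u‖ = ‖cfc (fun t : ℝ ↦ (t - x)⁻¹) T ((T - algebraMap ℝ (H →L[ℂ] H) x) u)‖ := by
        rw [← mul_apply_eq_comp, hinv, one_apply_eq_self]
    _ ≤ _ := ContinuousLinearMap.le_of_opNorm_le _ hnorm _

end IsSelfAdjoint

theorem spectrum_subset_of_relatively_bounded
    {H : Type*} [NormedAddCommGroup H] [InnerProductSpace ℂ H] [CompleteSpace H]
    (A B : H →L[ℂ] H) (hA : IsSelfAdjoint A) (hB : IsSelfAdjoint B)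
    (δ : ℝ) (hδ : δ ∈ Set.Icc (0 : ℝ) (1 / 2))
    (hrel : ∀ u : H, ‖B u‖ ≤ δ * (‖A u‖ + ‖u‖)) :
    spectrum ℝ (A + B) ⊆ {x : ℝ | Metric.infDist x (spectrum ℝ A) ≤ 2 * δ * (|x| + 1)} := by
  intro x hx
  by_contra hlt
  simp only [Set.mem_ofPred_eq, not_le] at hlt
  obtain ⟨hδ₀, hδ₁⟩ := hδ
  set d := Metric.infDist x (spectrum ℝ A)
  have hsa : IsSelfAdjoint (A + B - algebraMap ℝ (H →L[ℂ] H) x) :=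
    (hA.add hB).sub (.algebraMap _ (.all x))
  have hpos : 0 < (1 - δ) * d - δ * (|x| + 1) := by
    have : 0 ≤ 2 * δ * (|x| + 1) := by positivity
    nlinarith
  refine hx ((IsUnit.sub_iff).1 (hsa.isUnit_of_forall_mul_norm_le hpos fun u ↦ ?_))
  have hres : d * ‖u‖ ≤ ‖(A - algebraMap ℝ (H →L[ℂ] H) x) u‖ :=
    hA.infDist_spectrum_mul_norm_le x u
  have hAu : ‖A u‖ ≤ ‖(A - algebraMap ℝ (H →L[ℂ] H) x) u‖ + |x| * ‖u‖ := by
    simpa [Algebra.algebraMap_eq_smul_one, norm_smul] using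
      norm_add_le ((A - algebraMap ℝ (H →L[ℂ] H) x) u) (x • u)
  have hsum : ‖(A - algebraMap ℝ (H →L[ℂ] H) x) u‖ - ‖B u‖ ≤
      ‖(A + B - algebraMap ℝ (H →L[ℂ] H) x) u‖ := by
    rw [add_sub_right_comm, add_apply]
    exact norm_sub_le_norm_add _ _
  have hBu := (hrel u).trans (mul_le_mul_of_nonneg_left (add_le_add_left hAu ‖u‖) hδ₀)
  have := mul_le_mul_of_nonneg_left hres (by linarith : 0 ≤ 1 - δ)
  linarith
end

section
/- Assume: H is a complex Hilbert space; A : H → H is a bounded self-adjoint operator; Λ₀ is an eigenvalue of A with unit eigenvector ψ₀; B₁ and B₂ are bounded self-adjoint operators on H; Λ₁ := ⟨B₁ψ₀, ψ₀⟩; ψ₁ is a vector orthogonal to ψ₀ satisfying (A − Λ₀ I)ψ₁ = −B₁ψ₀ + Λ₁ψ₀; Λ₂ := ⟨B₁ψ₁, ψ₀⟩ + ⟨B₂ψ₀, ψ₀⟩. Let t ∈ ℝ and let B₃(t) be a bounded self-adjoint operator on H. Then, with φ(t) := ψ₀ + tψ₁, one has the exact identity ⟨(A + tB₁ + t²B₂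 + t³B₃(t))φ(t), φ(t)⟩ = (Λ₀ + tΛ₁ + t²Λ₂)(1 + t²‖ψ₁‖²) + t³Λ₃(t), where Λ₃(t) := −(Λ₁ + tΛ₂)‖ψ₁‖² + 2 Re⟨B₂ψ₀, ψ₁⟩ + ⟨(B₁ + tB₂)ψ₁, ψ₁⟩ + ⟨B₃(t)(ψ₀ + tψ₁), ψ₀ + tψ₁⟩. -/
open scoped ComplexInnerProductSpace

theorem rayleigh_quotient_exact_expansion
    {H : Type*} [NormedAddCommGroup H] [InnerProductSpace ℂ H] [CompleteSpace H]
    (A B₁ B₂ B₃t : H →L[ℂ] H)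
    (hA : IsSelfAdjoint A) (hB₁ : IsSelfAdjoint B₁)
    (hB₂ : IsSelfAdjoint B₂) (hB₃ : IsSelfAdjoint B₃t)
    (Λ₀ Λ₁ Λ₂ Λ₃ t : ℝ) (ψ₀ ψ₁ : H)
    (hψ₀ : ‖ψ₀‖ = 1) (heig : A ψ₀ = Λ₀ • ψ₀)
    (hΛ₁ : (Λ₁ : ℂ) = ⟪B₁ ψ₀, ψ₀⟫)
    (horth : ⟪ψ₀, ψ₁⟫ = 0)
    (hψ₁ : A ψ₁ - Λ₀ • ψ₁ = -(B₁ ψ₀) + Λ₁ • ψ₀)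
    (hΛ₂ : (Λ₂ : ℂ) = ⟪B₁ ψ₁, ψ₀⟫ + ⟪B₂ ψ₀, ψ₀⟫)
    (hΛ₃ : (Λ₃ : ℂ) = ((-(Λ₁ + t * Λ₂) * ‖ψ₁‖ ^ 2 + 2 * (⟪B₂ ψ₀, ψ₁⟫).re : ℝ) : ℂ)
        + ⟪(B₁ + t • B₂) ψ₁, ψ₁⟫ + ⟪B₃t (ψ₀ + t • ψ₁), ψ₀ + t • ψ₁⟫) :
    ⟪(A + t • B₁ + t ^ 2 • B₂ + t ^ 3 • B₃t) (ψ₀ + t • ψ₁), ψ₀ + t • ψ₁⟫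
      = (((Λ₀ + t * Λ₁ + t ^ 2 * Λ₂) * (1 + t ^ 2 * ‖ψ₁‖ ^ 2) + t ^ 3 * Λ₃ : ℝ) : ℂ) := by
  have h00 : ⟪ψ₀, ψ₀⟫ = 1 := by simp [inner_self_eq_norm_sq_to_K, hψ₀]
  have h11 : ⟪ψ₁, ψ₁⟫ = (‖ψ₁‖ : ℂ) ^ 2 := by simp [inner_self_eq_norm_sq_to_K]
  have horth' : ⟪ψ₁, ψ₀⟫ = 0 := inner_eq_zero_symm.mp horth
  have hAψ₁ : A ψ₁ = Λ₀ • ψ₁ - B₁ ψ₀ + Λ₁ • ψ₀ := by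
    rw [sub_eq_iff_eq_add.mp hψ₁]
    abel
  have hcross : ⟪B₂ ψ₀, ψ₁⟫ + ⟪B₂ ψ₁, ψ₀⟫ = 2 * ((⟪B₂ ψ₀, ψ₁⟫).re : ℂ) := by
    have hsymm : ⟪B₂ ψ₁, ψ₀⟫ = ⟪ψ₁, B₂ ψ₀⟫ := hB₂.isSymmetric ψ₁ ψ₀
    rw [hsymm, ← inner_conj_symm ψ₁ (B₂ ψ₀), Complex.add_conj]
    push_cast
    ring
  simp only [add_apply, smul_apply] at hΛ₃ ⊢
  push_cast at hΛ₃ ⊢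
  rw [hΛ₃, ← hcross]
  simp only [map_add, map_pow,
    ContinuousLinearMap.map_smul_of_tower, heig, hAψ₁, ← Complex.coe_smul, inner_add_left,
    inner_add_right, inner_sub_left, inner_smul_left, inner_smul_right, Complex.conj_ofReal,
    Complex.ofReal_pow, h00, h11, horth, horth', ← hΛ₁]
  linear_combination (-(t : ℂ) ^ 2) * hΛ₂
end

section
/- Assume: H is a complex Hilbert space; A : H → H is a bounded self-adjoint operator; Λ₀ is an eigenvalue of A with unit eigenvector ψ₀; B₁ and B₂ are bounded self-adjoint operators on H; Λ₁ := ⟨B₁ψ₀, ψ₀⟩; ψ₁ is a vector orthogonal to ψ₀ satisfying (A − Λ₀ I)ψ₁ = −B₁ψ₀ + Λ₁ψ₀; Λ₂ := ⟨B₁ψ₁, ψ₀⟩ + ⟨B₂ψ₀, ψ₀⟩. Let t ∈ ℝ and B₃(t) a bounded self-adjoint operator on H. Then inf spec(A + tB₁ + t²B₂ + t³B₃(t)) ≤ Λ₀ + tΛ₁ + t²Λ₂ + t³Λ₃(t)/(1 + t²‖ψ₁‖²), where Λ₃(t) := −(Λ₁ + tΛ₂)‖ψ₁‖² + 2 Re⟨B₂ψ₀,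 ψ₁⟩ + ⟨(B₁ + tB₂)ψ₁, ψ₁⟩ + ⟨B₃(t)(ψ₀ + tψ₁), ψ₀ + tψ₁⟩. -/
open scoped ComplexInnerProductSpace

/-- The bottom of the spectrum of a bounded self-adjoint operator bounds its quadratic form from
below. -/
theorem IsSelfAdjoint.sInf_spectrum_mul_norm_sq_le_re_inner
    {H : Type*} [NormedAddCommGroup H] [InnerProductSpace ℂ H] [CompleteSpace H]
    {T : H →L[ℂ] H} (hT : IsSelfAdjoint T) (u : H) :
    sInf (spectrum ℝ T) * ‖u‖ ^ 2 ≤ (⟪T u, u⟫).re := by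
  have hle : algebraMap ℝ (H →L[ℂ] H) (sInf (spectrum ℝ T)) ≤ T := by
    rw [algebraMap_le_iff_le_spectrum (a := T)]
    exact fun x hx => csInf_le (spectrum.isCompact T).bddBelow hx
  have hpos := ((ContinuousLinearMap.le_def _ _).1 hle).re_inner_nonneg_left u
  have hu : (⟪u, u⟫).re = ‖u‖ ^ 2 := inner_self_eq_norm_sq (𝕜 := ℂ) u
  rw [Algebra.algebraMap_eq_smul_one, sub_apply,
    smul_apply, one_apply_eq_self, inner_sub_left,
    inner_smul_left_eq_smul] at hpos
  simp only [Complex.real_smul, map_sub, RCLike.re_to_complex, Complex.re_ofReal_mul, hu] at hpos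
  linarith

/-- The real part of the sesquilinear form of a self-adjoint operator is symmetric. -/
theorem IsSelfAdjoint.re_inner_apply_comm
    {H : Type*} [NormedAddCommGroup H] [InnerProductSpace ℂ H] [CompleteSpace H]
    {T : H →L[ℂ] H} (hT : IsSelfAdjoint T) (x y : H) :
    (⟪T x, y⟫).re = (⟪T y, x⟫).re := by
  rw [hT.isSymmetric.apply_clm x y]
  exact inner_re_symm (𝕜 := ℂ) x (T y)

/-- Expansion of the quadratic form of a self-adjoint operator along a line. -/
theorem IsSelfAdjoint.re_inner_apply_add_smul
    {H : Type*} [NormedAddCommGroup H] [InnerProductSpace ℂ H] [CompleteSpace H]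
    {T : H →L[ℂ] H} (hT : IsSelfAdjoint T) (x y : H) (t : ℝ) :
    (⟪T (x + t • y), x + t • y⟫).re
      = (⟪T x, x⟫).re + 2 * t * (⟪T x, y⟫).re + t ^ 2 * (⟪T y, y⟫).re := by
  have hxy := hT.re_inner_apply_comm y x
  rw [map_add, T.map_smul_of_tower, inner_add_left, inner_add_right, inner_add_right]
  simp only [inner_smul_left_eq_smul, inner_smul_right_eq_smul, Complex.real_smul, Complex.add_re,
    Complex.re_ofReal_mul, hxy]
  ring

theorem inf_spectrum_upper_bound_second_order
    {H : Type*} [NormedAddCommGroup H] [InnerProductSpace ℂ H] [CompleteSpace H]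
    (A B₁ B₂ B₃t : H →L[ℂ] H)
    (hA : IsSelfAdjoint A) (hB₁ : IsSelfAdjoint B₁)
    (hB₂ : IsSelfAdjoint B₂) (hB₃ : IsSelfAdjoint B₃t)
    (Λ₀ Λ₁ Λ₂ Λ₃ t : ℝ) (ψ₀ ψ₁ : H)
    (hψ₀ : ‖ψ₀‖ = 1) (heig : A ψ₀ = Λ₀ • ψ₀)
    (hΛ₁ : (Λ₁ : ℂ) = ⟪B₁ ψ₀, ψ₀⟫)
    (horth : ⟪ψ₀, ψ₁⟫ = 0)
    (hψ₁ : A ψ₁ - Λ₀ • ψ₁ = -(B₁ ψ₀) + Λ₁ • ψ₀)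
    (hΛ₂ : (Λ₂ : ℂ) = ⟪B₁ ψ₁, ψ₀⟫ + ⟪B₂ ψ₀, ψ₀⟫)
    (hΛ₃ : (Λ₃ : ℂ) = ((-(Λ₁ + t * Λ₂) * ‖ψ₁‖ ^ 2 + 2 * (⟪B₂ ψ₀, ψ₁⟫).re : ℝ) : ℂ)
        + ⟪(B₁ + t • B₂) ψ₁, ψ₁⟫ + ⟪B₃t (ψ₀ + t • ψ₁), ψ₀ + t • ψ₁⟫) :
    sInf (spectrum ℝ (A + t • B₁ + t ^ 2 • B₂ + t ^ 3 • B₃t))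
      ≤ Λ₀ + t * Λ₁ + t ^ 2 * Λ₂ + t ^ 3 * Λ₃ / (1 + t ^ 2 * ‖ψ₁‖ ^ 2) := by
  have hsa (s : ℝ) {B : H →L[ℂ] H} (hB : IsSelfAdjoint B) : IsSelfAdjoint (s • B) :=
    (IsSelfAdjoint.all s).smul hB
  have hT : IsSelfAdjoint (A + t • B₁ + t ^ 2 • B₂ + t ^ 3 • B₃t) :=
    ((hA.add (hsa t hB₁)).add (hsa _ hB₂)).add (hsa _ hB₃)
  have hself (v : H) : (⟪v, v⟫).re = ‖v‖ ^ 2 := inner_self_eq_norm_sq (𝕜 := ℂ) v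
  have hnorm : ‖ψ₀ + t • ψ₁‖ ^ 2 = 1 + t ^ 2 * ‖ψ₁‖ ^ 2 := by
    have h := (IsSelfAdjoint.one (H →L[ℂ] H)).re_inner_apply_add_smul ψ₀ ψ₁ t
    simpa only [one_apply_eq_self, hself, horth, hψ₀, Complex.zero_re, mul_zero,
      add_zero, one_pow] using h
  have hpos : 0 < 1 + t ^ 2 * ‖ψ₁‖ ^ 2 := by positivity
  have hA₀₀ : (⟪A ψ₀, ψ₀⟫).re = Λ₀ := by
    rw [heig, inner_smul_left_eq_smul, Complex.real_smul, Complex.re_ofReal_mul, hself, hψ₀]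
    ring
  have hA₀₁ : (⟪A ψ₀, ψ₁⟫).re = 0 := by
    rw [heig, inner_smul_left_eq_smul, horth, smul_zero, Complex.zero_re]
  have hA₁₁ : (⟪A ψ₁, ψ₁⟫).re = Λ₀ * ‖ψ₁‖ ^ 2 - (⟪B₁ ψ₀, ψ₁⟫).re := by
    rw [sub_eq_iff_eq_add.1 hψ₁, inner_add_left, inner_add_left, inner_neg_left,
      inner_smul_left_eq_smul, inner_smul_left_eq_smul, horth]
    simp only [Complex.real_smul, Complex.add_re, Complex.neg_re, Complex.re_ofReal_mul, hself,
      Complex.zero_re]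
    ring
  have hB₁₀₀ := congrArg Complex.re hΛ₁
  have hΛ₂re := congrArg Complex.re hΛ₂
  have hΛ₃re := congrArg Complex.re hΛ₃
  rw [Complex.ofReal_re] at hB₁₀₀
  rw [Complex.ofReal_re, Complex.add_re, hB₁.re_inner_apply_comm] at hΛ₂re
  rw [Complex.ofReal_re, Complex.add_re, Complex.add_re, Complex.ofReal_re,
    add_apply, smul_apply, inner_add_left,
    inner_smul_left_eq_smul, Complex.add_re, Complex.real_smul, Complex.re_ofReal_mul] at hΛ₃re
  have hquot := hT.sInf_spectrum_mul_norm_sq_le_re_inner (ψ₀ + t • ψ₁)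
  simp only [add_apply, smul_apply, inner_add_left _ _ (ψ₀ + t • ψ₁),
    inner_smul_left_eq_smul _ (ψ₀ + t • ψ₁), Complex.add_re, Complex.real_smul,
    Complex.re_ofReal_mul] at hquot
  rw [hA.re_inner_apply_add_smul, hB₁.re_inner_apply_add_smul, hB₂.re_inner_apply_add_smul,
    hnorm, hA₀₀, hA₀₁, hA₁₁, ← hB₁₀₀] at hquot
  rw [← sub_le_iff_le_add', le_div_iff₀ hpos, hΛ₃re]
  linear_combination hquot - t ^ 2 * hΛ₂re
end

section
/- Assume: H is a complex Hilbert space; A : H → H is a bounded self-adjoint operator; Λ₀ := inf spec(A); Λ₀ is an eigenvalue of A with unit eigenvector ψ₀; ker(A − Λ₀ I) = ℂ·ψ₀; and for some constant c₁ > 0 the spectral gap condition spec(A) ∩ (Λ₀, Λ₀ + c₁) = ∅ holds. Let B₁, B₂ be bounded self-adjoint operators on H, Λ₁ := ⟨B₁ψ₀, ψ₀⟩, let ψ₁ be the unique vector orthogonal to ψ₀ with (A − Λ₀ I)ψ₁ = −B₁ψ₀ + Λ₁ψ₀, and Λ₂ := ⟨B₁ψ₁, ψ₀⟩ + ⟨B₂ψ₀,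 ψ₀⟩. Let t ↦ B₃(t) be a map from [−t₀, t₀] (t₀ > 0) into the bounded self-adjoint operators on H with sup_{|t|≤t₀} ‖B₃(t)‖ < ∞. Then there exist constants C ≥ 0 and t₁ ∈ (0, t₀] such that for all t with |t| ≤ t₁: inf spec(A + tB₁ + t²B₂ + t³B₃(t)) ≥ Λ₀ + tΛ₁ + t²Λ₂ − C|t|³. -/
open scoped ComplexInnerProductSpace

section
variable {H : Type*} [NormedAddCommGroup H] [InnerProductSpace ℂ H]

theorem le_sInf_spectrum_of_le_re_inner [CompleteSpace H] [Nontrivial H]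
    {T : H →L[ℂ] H} (hT : IsSelfAdjoint T) {E : ℝ}
    (h : ∀ u : H, E * ‖u‖ ^ 2 ≤ (⟪T u, u⟫).re) : E ≤ sInf (spectrum ℝ T) := by
  refine le_csInf (ContinuousFunctionalCalculus.spectrum_nonempty T hT) fun x hx => ?_
  refine (algebraMap_le_iff_le_spectrum (r := E) (a := T)).1 ?_ x hx
  rw [ContinuousLinearMap.le_def, ContinuousLinearMap.isPositive_def']
  refine ⟨hT.sub (IsSelfAdjoint.algebraMap _ (IsSelfAdjoint.all E)), fun u => ?_⟩
  have := h u
  simp only [ContinuousLinearMap.reApplyInnerSelf_apply, sub_apply, inner_sub_left,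
    Algebra.algebraMap_eq_smul_one, smul_apply, one_apply_eq_self,
    ← Complex.coe_smul, inner_smul_left, inner_self_eq_norm_sq_to_K]
  simpa [← Complex.ofReal_pow] using this

theorem gap_le_re_inner_of_mem_ker_orthogonal [CompleteSpace H]
    {A : H →L[ℂ] H} (hA : IsSelfAdjoint A) {a c : ℝ}
    (hspec : ∀ x ∈ spectrum ℝ A, x = a ∨ a + c ≤ x)
    {w : H} (hw : ∀ v : H, A v = a • v → ⟪v, w⟫ = 0) :
    c * ‖w‖ ^ 2 ≤ (⟪A w - a • w, w⟫).re := by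
  set D : H →L[ℂ] H := A - algebraMap ℝ _ a with hD
  have hDw (v : H) : D v = A v - a • v := by
    simp [hD, Algebra.algebraMap_eq_smul_one]
  have hDsa : IsSelfAdjoint D := hA.sub (IsSelfAdjoint.algebraMap _ (IsSelfAdjoint.all a))
  have hpos : 0 ≤ D * (D - algebraMap ℝ _ c) * D := by
    have h1 : cfc (fun x : ℝ => (x - a) * ((x - a) - c) * (x - a)) A
        = D * (D - algebraMap ℝ _ c) * D := by
      have hDcfc : cfc (fun x : ℝ => x - a) A = D := by
        rw [cfc_sub .., cfc_id' .., cfc_const ..]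
      rw [cfc_mul .., cfc_mul .., cfc_sub (fun x : ℝ => x - a) (fun _ => c) A, cfc_const ..,
        hDcfc]
    rw [← h1]
    refine cfc_nonneg fun x hx => ?_
    rcases hspec x hx with rfl | h
    · simp
    · have : 0 ≤ (x - a) ^ 2 * (x - a - c) := mul_nonneg (sq_nonneg _) (by linarith)
      linarith
  have hrange (v : H) : c * ‖D v‖ ^ 2 ≤ (⟪D (D v), D v⟫).re := by
    have h := ((ContinuousLinearMap.nonneg_iff_isPositive _).1 hpos).re_inner_nonneg_left v
    simp only [mul_apply_eq_comp] at h
    rw [← ContinuousLinearMap.adjoint_inner_right, ← ContinuousLinearMap.star_eq_adjoint,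
      hDsa.star_eq] at h
    simp only [sub_apply, inner_sub_left,
      Algebra.algebraMap_eq_smul_one, smul_apply,
      one_apply_eq_self, ← Complex.coe_smul, inner_smul_left,
      inner_self_eq_norm_sq_to_K] at h
    simpa [← Complex.ofReal_pow] using h
  have hmem : w ∈ closure (Set.range D) := by
    have h := ContinuousLinearMap.orthogonal_ker D
    rw [← ContinuousLinearMap.star_eq_adjoint, hDsa.star_eq] at h
    have hw' : w ∈ (LinearMap.ker D.toLinearMap)ᗮ := by
      rw [Submodule.mem_orthogonal]
      intro v hv
      exact hw v (sub_eq_zero.1 (by rw [← hDw]; exact hv))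
    rw [h] at hw'
    exact hw'
  rw [← hDw]
  have hclosed : IsClosed {v : H | c * ‖v‖ ^ 2 ≤ (⟪D v, v⟫).re} :=
    isClosed_le (by fun_prop) (by fun_prop)
  refine closure_minimal ?_ hclosed hmem
  rintro _ ⟨v, rfl⟩
  exact hrange v

theorem le_re_inner_smul_add {K : H →L[ℂ] H} (hK : (K : H →ₗ[ℂ] H).IsSymmetric)
    {γ : ℝ} (hγ : 0 < γ) (φ w : H) (α : ℂ) (hw : γ * ‖w‖ ^ 2 ≤ (⟪K w, w⟫).re) :
    ‖α‖ ^ 2 * ((⟪K φ, φ⟫).re - ‖K φ‖ ^ 2 / γ) ≤ (⟪K (α • φ + w), α • φ + w⟫).re := by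
  have hsym : (⟪K w, α • φ⟫).re = (⟪K (α • φ), w⟫).re := by
    have : ⟪K w, α • φ⟫ = ⟪w, K (α • φ)⟫ := hK w (α • φ)
    rw [this, ← inner_conj_symm, Complex.conj_re]
  have hφ : (⟪K (α • φ), α • φ⟫).re = ‖α‖ ^ 2 * (⟪K φ, φ⟫).re := by
    rw [map_smul, inner_smul_left, inner_smul_right, ← mul_assoc, mul_comm (starRingEnd ℂ α),
      Complex.mul_conj, Complex.normSq_eq_norm_sq, Complex.re_ofReal_mul]
  have hcross : -(‖α‖ * ‖K φ‖ * ‖w‖) ≤ (⟪K (α • φ), w⟫).re := by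
    have h := (abs_le.1 ((Complex.abs_re_le_norm _).trans (norm_inner_le_norm (𝕜 := ℂ) (K (α • φ)) w))).1
    rwa [map_smul, norm_smul, ← map_smul] at h
  have hexp : (⟪K (α • φ + w), α • φ + w⟫).re =
      ‖α‖ ^ 2 * (⟪K φ, φ⟫).re + 2 * (⟪K (α • φ), w⟫).re + (⟪K w, w⟫).re := by
    rw [map_add, inner_add_left, inner_add_right, inner_add_right]
    simp only [Complex.add_re, hsym, hφ]
    ring
  have hsq : 0 ≤ (‖α‖ * ‖K φ‖ - γ * ‖w‖) ^ 2 / γ := by positivity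
  have hsq' : (‖α‖ * ‖K φ‖ - γ * ‖w‖) ^ 2 / γ =
      ‖α‖ ^ 2 * (‖K φ‖ ^ 2 / γ) - 2 * (‖α‖ * ‖K φ‖ * ‖w‖) + γ * ‖w‖ ^ 2 := by
    field_simp
    ring
  rw [hexp]
  linarith

theorem neg_le_re_inner_sq_smul (r s ψ₀ ψ₁ : H) (hψ₀ : ‖ψ₀‖ = 1) (hr : ⟪r, ψ₀⟫ = 0)
    {t : ℝ} (ht : |t| ≤ 1) :
    -(|t| ^ 3 * (‖r‖ * ‖ψ₁‖ + ‖s‖ * (1 + ‖ψ₁‖))) ≤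
      (⟪t ^ 2 • (r + t • s), ψ₀ + t • ψ₁⟫).re := by
  have hexp : ⟪t ^ 2 • (r + t • s), ψ₀ + t • ψ₁⟫ =
      ((t ^ 3 : ℝ) : ℂ) * (⟪r, ψ₁⟫ + ⟪s, ψ₀ + t • ψ₁⟫) := by
    simp only [← Complex.coe_smul, inner_add_left, inner_add_right, inner_smul_left,
      inner_smul_right, hr, Complex.conj_ofReal]
    push_cast
    ring
  have hφ : ‖ψ₀ + t • ψ₁‖ ≤ 1 + ‖ψ₁‖ := by
    refine (norm_add_le _ _).trans ?_
    rw [norm_smul, hψ₀, Real.norm_eq_abs]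
    gcongr
    exact mul_le_of_le_one_left (norm_nonneg _) ht
  have hnorm : ‖⟪t ^ 2 • (r + t • s), ψ₀ + t • ψ₁⟫‖ ≤
      |t| ^ 3 * (‖r‖ * ‖ψ₁‖ + ‖s‖ * (1 + ‖ψ₁‖)) := by
    rw [hexp, norm_mul, Complex.norm_real, Real.norm_eq_abs, abs_pow]
    gcongr
    refine (norm_add_le _ _).trans ?_
    gcongr
    · exact norm_inner_le_norm _ _
    · exact (norm_inner_le_norm _ _).trans (by gcongr)
  exact (abs_le.1 ((Complex.abs_re_le_norm _).trans hnorm)).1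

theorem neg_norm_mul_le_re_inner (T : H →L[ℂ] H) (w : H) :
    -(‖T‖ * ‖w‖ ^ 2) ≤ (⟪T w, w⟫).re := by
  have h : ‖⟪T w, w⟫‖ ≤ ‖T‖ * ‖w‖ ^ 2 := by
    refine (norm_inner_le_norm _ _).trans ?_
    rw [sq, ← mul_assoc]
    gcongr
    exact T.le_opNorm w
  exact (abs_le.1 ((Complex.abs_re_le_norm _).trans h)).1

theorem re_inner_smul_one_apply (a : ℝ) (w : H) :
    (⟪(a • (1 : H →L[ℂ] H)) w, w⟫).re = a * ‖w‖ ^ 2 := by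
  rw [smul_apply, one_apply_eq_self, ← Complex.coe_smul, inner_smul_left, Complex.conj_ofReal,
    Complex.re_ofReal_mul, inner_self_eq_norm_sq_to_K]
  simp [← Complex.ofReal_pow]

end

theorem inf_spectrum_lower_bound_second_order
    {H : Type*} [NormedAddCommGroup H] [InnerProductSpace ℂ H] [CompleteSpace H]
    (A B₁ B₂ : H →L[ℂ] H)
    (hA : IsSelfAdjoint A) (hB₁ : IsSelfAdjoint B₁) (hB₂ : IsSelfAdjoint B₂)
    (Λ₀ c₁ : ℝ) (hΛ₀ : Λ₀ = sInf (spectrum ℝ A))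
    (ψ₀ : H) (hψ₀ : ‖ψ₀‖ = 1) (heig : A ψ₀ = Λ₀ • ψ₀)
    (hker : ∀ u : H, A u = Λ₀ • u → ∃ c : ℂ, u = c • ψ₀)
    (hc₁ : 0 < c₁) (hgap : spectrum ℝ A ∩ Set.Ioo Λ₀ (Λ₀ + c₁) = ∅)
    (Λ₁ Λ₂ : ℝ) (hΛ₁ : (Λ₁ : ℂ) = ⟪B₁ ψ₀, ψ₀⟫)
    (ψ₁ : H) (horth : ⟪ψ₀, ψ₁⟫ = 0)
    (hψ₁ : A ψ₁ - Λ₀ • ψ₁ = -(B₁ ψ₀) + Λ₁ • ψ₀)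
    (hΛ₂ : (Λ₂ : ℂ) = ⟪B₁ ψ₁, ψ₀⟫ + ⟪B₂ ψ₀, ψ₀⟫)
    (t₀ : ℝ) (ht₀ : 0 < t₀) (B₃ : ℝ → H →L[ℂ] H)
    (hB₃sa : ∀ t ∈ Set.Icc (-t₀) t₀, IsSelfAdjoint (B₃ t))
    (hB₃bdd : ∃ M : ℝ, ∀ t ∈ Set.Icc (-t₀) t₀, ‖B₃ t‖ ≤ M) :
    ∃ C : ℝ, 0 ≤ C ∧ ∃ t₁ ∈ Set.Ioc (0 : ℝ) t₀, ∀ t : ℝ, |t| ≤ t₁ →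
      Λ₀ + t * Λ₁ + t ^ 2 * Λ₂ - C * |t| ^ 3
        ≤ sInf (spectrum ℝ (A + t • B₁ + t ^ 2 • B₂ + t ^ 3 • B₃ t)) := by
  have : Nontrivial H := ⟨⟨ψ₀, 0, by rintro rfl; simp at hψ₀⟩⟩
  obtain ⟨M, hM⟩ := hB₃bdd
  have hM0 : 0 ≤ M := (norm_nonneg _).trans (hM 0 ⟨by linarith, ht₀.le⟩)
  have hspec : ∀ x ∈ spectrum ℝ A, x = Λ₀ ∨ Λ₀ + c₁ ≤ x := by
    intro x hx
    have hle : Λ₀ ≤ x := hΛ₀ ▸ csInf_le (spectrum.isCompact A).bddBelow hx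
    by_contra! hcon
    exact Set.notMem_empty x (hgap ▸ ⟨hx, lt_of_le_of_ne hle hcon.1.symm, hcon.2⟩)
  have hgapform (w : H) (hw : ⟪ψ₀, w⟫ = 0) : c₁ * ‖w‖ ^ 2 ≤ (⟪A w - Λ₀ • w, w⟫).re := by
    refine gap_le_re_inner_of_mem_ker_orthogonal hA hspec fun v hv => ?_
    obtain ⟨c, rfl⟩ := hker v hv
    rw [inner_smul_left, hw, mul_zero]
  set r : H := B₁ ψ₁ + B₂ ψ₀ - Λ₁ • ψ₁ - Λ₂ • ψ₀ with hr
  have hrψ₀ : ⟪r, ψ₀⟫ = 0 := by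
    have h : ⟪ψ₁, ψ₀⟫ = 0 := by rw [← inner_conj_symm, horth, map_zero]
    have h1 : ⟪ψ₀, ψ₀⟫ = 1 := by rw [inner_self_eq_norm_sq_to_K, hψ₀]; simp
    rw [hr, ← Complex.coe_smul, ← Complex.coe_smul]
    simp only [inner_sub_left, inner_add_left, inner_smul_left, Complex.conj_ofReal, h, h1]
    rw [hΛ₂]
    ring
  set S : ℝ := ‖B₂ ψ₁ - Λ₂ • ψ₁‖ + M + M * ‖ψ₁‖ with hS
  set N : ℝ := ‖B₁‖ + |Λ₁| + ‖B₂‖ + |Λ₂| + M with hN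
  have hS0 : 0 ≤ S := by positivity
  have hN0 : 0 ≤ N := by positivity
  set γ : ℝ := c₁ / 2 with hγ
  have hγ0 : 0 < γ := by positivity
  refine ⟨‖r‖ * ‖ψ₁‖ + S * (1 + ‖ψ₁‖) + (‖r‖ + S) ^ 2 / γ, by positivity,
    min t₀ (min 1 (γ / (N + 1))), ⟨by positivity, min_le_left _ _⟩, fun t ht => ?_⟩
  set C : ℝ := ‖r‖ * ‖ψ₁‖ + S * (1 + ‖ψ₁‖) + (‖r‖ + S) ^ 2 / γ with hC
  have hC0 : 0 ≤ C := by positivity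
  have htt₀ : |t| ≤ t₀ := ht.trans (min_le_left _ _)
  have ht1 : |t| ≤ 1 := ht.trans ((min_le_right _ _).trans (min_le_left _ _))
  have htN : |t| * N ≤ γ := by
    have h : |t| ≤ γ / (N + 1) := ht.trans ((min_le_right _ _).trans (min_le_right _ _))
    rw [le_div_iff₀ (by positivity)] at h
    linarith [abs_nonneg t]
  have htmem : t ∈ Set.Icc (-t₀) t₀ := abs_le.1 htt₀
  have hMt := hM t htmem
  have hB₃t := hB₃sa t htmem
  set T : H →L[ℂ] H := A + t • B₁ + t ^ 2 • B₂ + t ^ 3 • B₃ t with hT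
  have hTsa : IsSelfAdjoint T := by
    refine ((hA.add ?_).add ?_).add ?_
    · exact (IsSelfAdjoint.all t).smul hB₁
    · exact (IsSelfAdjoint.all (t ^ 2)).smul hB₂
    · exact (IsSelfAdjoint.all (t ^ 3)).smul hB₃t
  set E : ℝ := Λ₀ + t * Λ₁ + t ^ 2 * Λ₂ with hE
  set K : H →L[ℂ] H := T - E • (1 : H →L[ℂ] H) with hK
  have hKsa : IsSelfAdjoint K :=
    hTsa.sub ((IsSelfAdjoint.all E).smul (IsSelfAdjoint.one _))
  set s : H := B₂ ψ₁ - Λ₂ • ψ₁ + B₃ t ψ₀ + t • B₃ t ψ₁ with hs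
  have hsS : ‖s‖ ≤ S := by
    have h0 : ‖B₃ t ψ₀‖ ≤ M := by
      simpa [hψ₀] using (B₃ t).le_of_opNorm_le hMt ψ₀
    have h1 : ‖t • B₃ t ψ₁‖ ≤ M * ‖ψ₁‖ := by
      rw [norm_smul, Real.norm_eq_abs]
      exact (mul_le_of_le_one_left (norm_nonneg _) ht1).trans
        ((B₃ t).le_of_opNorm_le hMt ψ₁)
    exact (norm_add₃_le).trans (add_le_add (add_le_add le_rfl h0) h1)
  set φ : H := ψ₀ + t • ψ₁ with hφ
  have hKφ : K φ = t ^ 2 • (r + t • s) := by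
    have hAψ₁ : A ψ₁ = Λ₀ • ψ₁ + (-(B₁ ψ₀) + Λ₁ • ψ₀) := by rw [← hψ₁]; abel
    have hsm (L : H →L[ℂ] H) (v : H) : L (t • v) = t • L v := by
      rw [← Complex.coe_smul, map_smul, Complex.coe_smul]
    simp only [hK, hT, hφ, sub_apply, add_apply, smul_apply, one_apply_eq_self, map_add, hsm,
      heig, hAψ₁, hr, hs, hE]
    module
  have hKφsq : ‖K φ‖ ^ 2 ≤ |t| ^ 3 * (‖r‖ + S) ^ 2 := by
    have h : ‖K φ‖ ≤ |t| ^ 2 * (‖r‖ + S) := by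
      rw [hKφ, norm_smul, Real.norm_eq_abs, abs_pow]
      gcongr
      refine (norm_add_le _ _).trans ?_
      gcongr
      rw [norm_smul, Real.norm_eq_abs]
      exact (mul_le_of_le_one_left (norm_nonneg _) ht1).trans hsS
    calc ‖K φ‖ ^ 2 ≤ (|t| ^ 2 * (‖r‖ + S)) ^ 2 := by gcongr
      _ = |t| ^ 4 * (‖r‖ + S) ^ 2 := by ring
      _ ≤ |t| ^ 3 * (‖r‖ + S) ^ 2 := by
        gcongr ?_ * _
        exact pow_le_pow_of_le_one (abs_nonneg t) ht1 (by norm_num)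
  have hφform : -(|t| ^ 3 * C) ≤ (⟪K φ, φ⟫).re - ‖K φ‖ ^ 2 / γ := by
    have h1 := neg_le_re_inner_sq_smul r s ψ₀ ψ₁ hψ₀ hrψ₀ ht1
    rw [← hKφ] at h1
    have h2 : |t| ^ 3 * (‖r‖ * ‖ψ₁‖ + ‖s‖ * (1 + ‖ψ₁‖)) ≤
        |t| ^ 3 * (‖r‖ * ‖ψ₁‖ + S * (1 + ‖ψ₁‖)) := by gcongr
    have h3 : ‖K φ‖ ^ 2 / γ ≤ |t| ^ 3 * ((‖r‖ + S) ^ 2 / γ) := by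
      rw [← mul_div_assoc]
      gcongr
    rw [hC, mul_add]
    linarith
  have hKw (w : H) (hw : ⟪ψ₀, w⟫ = 0) : γ * ‖w‖ ^ 2 ≤ (⟪K w, w⟫).re := by
    set P : H →L[ℂ] H := t • (B₁ - Λ₁ • 1) + t ^ 2 • (B₂ - Λ₂ • 1) + t ^ 3 • B₃ t with hP
    have hsplit : K w = (A w - Λ₀ • w) + P w := by
      simp only [hK, hT, hP, sub_apply, add_apply, smul_apply, one_apply_eq_self, hE]
      module
    have hone (a : ℝ) : ‖a • (1 : H →L[ℂ] H)‖ = |a| := by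
      rw [norm_smul, norm_one, mul_one, Real.norm_eq_abs]
    have hPnorm : ‖P‖ ≤ γ := by
      refine le_trans ?_ htN
      have h1 : ‖t • (B₁ - Λ₁ • 1)‖ ≤ |t| * (‖B₁‖ + |Λ₁|) := by
        rw [norm_smul, Real.norm_eq_abs, ← hone Λ₁]
        gcongr
        exact norm_sub_le _ _
      have h2 : ‖t ^ 2 • (B₂ - Λ₂ • 1)‖ ≤ |t| * (‖B₂‖ + |Λ₂|) := by
        rw [norm_smul, Real.norm_eq_abs, abs_pow, ← hone Λ₂]
        gcongr
        · exact pow_le_of_le_one (abs_nonneg t) ht1 (by norm_num)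
        · exact norm_sub_le _ _
      have h3 : ‖t ^ 3 • B₃ t‖ ≤ |t| * M := by
        rw [norm_smul, Real.norm_eq_abs, abs_pow]
        gcongr
        exact pow_le_of_le_one (abs_nonneg t) ht1 (by norm_num)
      refine (norm_add₃_le).trans ((add_le_add (add_le_add h1 h2) h3).trans_eq ?_)
      rw [hN]
      ring
    rw [hsplit, inner_add_left, Complex.add_re]
    have h1 := hgapform w hw
    have h2 := neg_norm_mul_le_re_inner P w
    have h3 : ‖P‖ * ‖w‖ ^ 2 ≤ γ * ‖w‖ ^ 2 := by gcongr
    have h4 : c₁ = γ + γ := by rw [hγ]; ring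
    rw [h4, add_mul] at h1
    linarith
  refine le_sInf_spectrum_of_le_re_inner hTsa fun u => ?_
  set α : ℂ := ⟪ψ₀, u⟫ with hα
  have hwψ₀ : ⟪ψ₀, u - α • φ⟫ = 0 := by
    rw [hφ, ← Complex.coe_smul, inner_sub_right, inner_smul_right, inner_add_right,
      inner_smul_right, horth, inner_self_eq_norm_sq_to_K, hψ₀]
    simp [hα]
  have hαu : ‖α‖ ^ 2 ≤ ‖u‖ ^ 2 := by
    have h := norm_inner_le_norm (𝕜 := ℂ) ψ₀ u
    rw [hψ₀, one_mul] at h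
    gcongr
  have hKu := le_re_inner_smul_add hKsa.isSymmetric hγ0 φ (u - α • φ) α (hKw _ hwψ₀)
  rw [add_sub_cancel] at hKu
  have hTu : (⟪T u, u⟫).re = (⟪K u, u⟫).re + E * ‖u‖ ^ 2 := by
    rw [← re_inner_smul_one_apply E u, ← Complex.add_re, ← inner_add_left, hK, sub_apply,
      sub_add_cancel]
  have hlow : -(|t| ^ 3 * C * ‖u‖ ^ 2) ≤ (⟪K u, u⟫).re := by
    have h1 := mul_le_mul_of_nonneg_left hφform (sq_nonneg ‖α‖)
    have h2 : |t| ^ 3 * C * ‖α‖ ^ 2 ≤ |t| ^ 3 * C * ‖u‖ ^ 2 := by gcongr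
    linarith
  rw [hTu]
  linarith
end

section
/- Assume: H is a complex Hilbert space; A : H → H is a bounded self-adjoint operator; Λ₀ := inf spec(A); Λ₀ is an eigenvalue of A with unit eigenvector ψ₀; ker(A − Λ₀ I) = ℂ·ψ₀; and for some constant c₁ > 0 the spectral gap condition spec(A) ∩ (Λ₀, Λ₀ + c₁) = ∅ holds. Let B₁, B₂ be bounded self-adjoint operators on H, Λ₁ := ⟨B₁ψ₀, ψ₀⟩, let ψ₁ be the unique vector orthogonal to ψ₀ with (A − Λ₀ I)ψ₁ = −B₁ψ₀ + Λ₁ψ₀, and Λ₂ := ⟨B₁ψ₁, ψ₀⟩ + ⟨B₂ψ₀, ψ₀⟩. Let t ↦ B₃(t) be a norm-continuous map from [−t₀, t₀] (t₀ > 0) into the bounded self-adjoint operators on H. Then there exist constants C ≥ 0 and t₁ ∈ (0, t₀] such that for all t with |t| ≤ t₁: |inf spec(A + tB₁ + t²B₂ + t³B₃(t)) − (Λ₀ + tΛ₁ + t²Λ₂)| ≤ C|t|³. -/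
open scoped ComplexInnerProductSpace

section

variable {H : Type*} [NormedAddCommGroup H] [InnerProductSpace ℂ H]

lemma ContinuousLinearMap.re_inner_sub_smul_self (T : H →L[ℂ] H) (m : ℝ) (u : H) :
    (⟪T u - m • u, u⟫).re = (⟪T u, u⟫).re - m * ‖u‖ ^ 2 := by
  rw [inner_sub_left, inner_smul_left_eq_smul, inner_self_eq_norm_sq_to_K, Complex.sub_re,
    Complex.smul_re, smul_eq_mul]
  norm_cast

variable [CompleteSpace H]

lemma IsSelfAdjoint.algebraMap_le_iff_re_inner {T : H →L[ℂ] H} (hT : IsSelfAdjoint T) (m : ℝ) :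
    algebraMap ℝ (H →L[ℂ] H) m ≤ T ↔ ∀ u : H, m * ‖u‖ ^ 2 ≤ (⟪T u, u⟫).re := by
  rw [ContinuousLinearMap.le_def, ContinuousLinearMap.isPositive_def',
    and_iff_right (hT.sub (IsSelfAdjoint.all m |>.algebraMap _))]
  refine forall_congr' fun u => ?_
  have h := T.re_inner_sub_smul_self m u
  rw [ContinuousLinearMap.reApplyInnerSelf_apply, Algebra.algebraMap_eq_smul_one]
  simp only [sub_apply, smul_apply,
    one_apply_eq_self, RCLike.re_to_complex, h, sub_nonneg]

lemma IsSelfAdjoint.le_sInf_spectrum_iff [Nontrivial H] {T : H →L[ℂ] H} (hT : IsSelfAdjoint T)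
    (m : ℝ) : m ≤ sInf (spectrum ℝ T) ↔ ∀ u : H, m * ‖u‖ ^ 2 ≤ (⟪T u, u⟫).re := by
  rw [← hT.algebraMap_le_iff_re_inner, algebraMap_le_iff_le_spectrum (ha := hT)]
  exact le_csInf_iff (spectrum.isCompact T).bddBelow
    (ContinuousFunctionalCalculus.spectrum_nonempty T hT)

/-- If `0` is an isolated lowest point of the spectrum, the quadratic form is bounded below by the
gap on the orthogonal complement of the kernel. -/
lemma IsSelfAdjoint.gap_mul_norm_sq_le_re_inner {S : H →L[ℂ] H} (hS : IsSelfAdjoint S)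
    {c : ℝ} (hspec : ∀ x ∈ spectrum ℝ S, x = 0 ∨ c ≤ x) {v : H} (hv : v ∈ S.kerᗮ) :
    c * ‖v‖ ^ 2 ≤ (⟪S v, v⟫).re := by
  have hpos : 0 ≤ S * (S - algebraMap ℝ _ c) * S := by
    have h : cfc (fun x : ℝ => x * (x - c) * x) S = S * (S - algebraMap ℝ _ c) * S := by
      rw [cfc_mul (fun x : ℝ => x * (x - c)) (fun x : ℝ => x) S,
        cfc_mul (fun x : ℝ => x) (fun x : ℝ => x - c) S,
        cfc_sub (fun x : ℝ => x) (fun _ : ℝ => c) S, cfc_id' ℝ S, cfc_const c S]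
    rw [← h]
    refine cfc_nonneg fun x hx => ?_
    rcases hspec x hx with rfl | hx
    · simp
    · nlinarith [mul_nonneg (sub_nonneg.2 hx) (mul_self_nonneg x)]
  have hrange : ∀ w ∈ S.range, c * ‖w‖ ^ 2 ≤ (⟪S w, w⟫).re := by
    rintro _ ⟨x, rfl⟩
    have h := (ContinuousLinearMap.nonneg_iff_isPositive _).1 hpos |>.re_inner_nonneg_left x
    have hsymm : ∀ y : H, ⟪S y, x⟫ = ⟪y, S x⟫ := fun y => hS.isSymmetric y x
    simp only [mul_apply_eq_comp, Algebra.algebraMap_eq_smul_one,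
      sub_apply, smul_apply,
      one_apply_eq_self, RCLike.re_to_complex, hsymm] at h
    rw [ContinuousLinearMap.re_inner_sub_smul_self] at h
    exact sub_nonneg.1 h
  rw [S.orthogonal_ker, hS.adjoint_eq] at hv
  have hclosed : IsClosed {w : H | c * ‖w‖ ^ 2 ≤ (⟪S w, w⟫).re} :=
    isClosed_le (by fun_prop) (Complex.continuous_re.comp (by fun_prop))
  exact closure_minimal hrange hclosed hv

/-- A Temple-type two-sided bound for the bottom of the spectrum from an approximate eigenvector
`φ`, normalized against `ψ`, and coercivity on the orthogonal complement of `ψ`. -/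
lemma IsSelfAdjoint.abs_sInf_spectrum_sub_le {T : H →L[ℂ] H} (hT : IsSelfAdjoint T)
    {μ δ ε κ : ℝ} {ψ φ : H} (hψ : ‖ψ‖ = 1) (hφ : ⟪ψ, φ⟫ = 1) (hδ : 0 < δ)
    (hcoer : ∀ v : H, ⟪ψ, v⟫ = 0 → δ * ‖v‖ ^ 2 ≤ (⟪T v - μ • v, v⟫).re)
    (hε : ‖T φ - μ • φ‖ ≤ ε) (hκ : |(⟪T φ - μ • φ, φ⟫).re| ≤ κ) :
    |sInf (spectrum ℝ T) - μ| ≤ κ + ε ^ 2 / δ := by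
  have : Nontrivial H := ⟨ψ, 0, fun h => by simp [h] at hψ⟩
  have hκ0 : 0 ≤ κ := (abs_nonneg _).trans hκ
  have hε0 : 0 ≤ ε := (norm_nonneg _).trans hε
  have hq : 0 ≤ ε ^ 2 / δ := by positivity
  have hφ1 : 1 ≤ ‖φ‖ := by simpa [hφ, hψ] using norm_inner_le_norm (𝕜 := ℂ) ψ φ
  rw [abs_sub_le_iff]
  constructor
  · have h := (hT.le_sInf_spectrum_iff _).1 le_rfl φ
    have h2 := (le_abs_self _).trans hκ
    rw [ContinuousLinearMap.re_inner_sub_smul_self] at h2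
    by_contra! hcon
    have : 1 ≤ ‖φ‖ ^ 2 := one_le_pow₀ hφ1
    nlinarith
  · suffices μ - (κ + ε ^ 2 / δ) ≤ sInf (spectrum ℝ T) by linarith
    refine (hT.le_sInf_spectrum_iff _).2 fun u => ?_
    set a : ℂ := ⟪ψ, u⟫ with ha
    have ha_le : ‖a‖ ≤ ‖u‖ := by simpa [hψ] using norm_inner_le_norm (𝕜 := ℂ) ψ u
    obtain ⟨v, hv⟩ : ∃ v, u = a • φ + v := ⟨u - a • φ, by abel⟩
    have hv0 : ⟪ψ, v⟫ = 0 := by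
      have : v = u - a • φ := by rw [hv]; abel
      rw [this, inner_sub_right, inner_smul_right, hφ, ← ha]; simp
    set r := T φ - μ • φ with hr
    have hsymm : ⟪T v - μ • v, φ⟫ = ⟪v, r⟫ := by
      rw [hr, inner_sub_left, inner_sub_right, hT.isSymmetric.apply_clm v φ,
        inner_smul_left_eq_smul, inner_smul_right_eq_smul]
    have hexp : (⟪T u - μ • u, u⟫).re
        = ‖a‖ ^ 2 * (⟪r, φ⟫).re + 2 * (⟪a • r, v⟫).re + (⟪T v - μ • v, v⟫).re := by
      have h1 : T u - μ • u = a • r + (T v - μ • v) := by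
        rw [hv, hr, map_add, map_smul, smul_add, smul_sub, smul_comm μ a φ]; abel
      have h2 : ⟪a • r, a • φ⟫ = ((‖a‖ ^ 2 : ℝ) : ℂ) * ⟪r, φ⟫ := by
        rw [inner_smul_left, inner_smul_right, ← mul_assoc, Complex.conj_mul']
        push_cast; rfl
      have h3 : (⟪T v - μ • v, a • φ⟫).re = (⟪a • r, v⟫).re := by
        rw [inner_smul_right, hsymm, ← inner_smul_right, ← inner_conj_symm, Complex.conj_re]
      rw [h1, hv, inner_add_left, inner_add_right, inner_add_right, h2]
      simp only [Complex.add_re, h3, Complex.re_ofReal_mul]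
      ring
    have hcross : |(⟪a • r, v⟫).re| ≤ ‖u‖ * ε * ‖v‖ := by
      refine (Complex.abs_re_le_norm _).trans ((norm_inner_le_norm _ _).trans ?_)
      rw [norm_smul]; gcongr
    have h1 := hcoer v hv0
    have h2 : -(κ * ‖u‖ ^ 2) ≤ ‖a‖ ^ 2 * (⟪r, φ⟫).re := by
      have : ‖a‖ ^ 2 * |(⟪r, φ⟫).re| ≤ ‖u‖ ^ 2 * κ := by gcongr
      nlinarith [neg_abs_le (⟪r, φ⟫).re, sq_nonneg ‖a‖]
    have h3 := (abs_le.1 hcross).1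
    have h4 : 0 ≤ δ * ‖v‖ ^ 2 - 2 * (‖u‖ * ε * ‖v‖) + ε ^ 2 / δ * ‖u‖ ^ 2 := by
      have : δ * ‖v‖ ^ 2 - 2 * (‖u‖ * ε * ‖v‖) + ε ^ 2 / δ * ‖u‖ ^ 2
          = (δ * ‖v‖ - ε * ‖u‖) ^ 2 / δ := by field_simp; ring
      rw [this]; positivity
    have h5 := T.re_inner_sub_smul_self μ u
    nlinarith

end

theorem inf_spectrum_two_sided_second_order
    {H : Type*} [NormedAddCommGroup H] [InnerProductSpace ℂ H] [CompleteSpace H]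
    (A B₁ B₂ : H →L[ℂ] H)
    (hA : IsSelfAdjoint A) (hB₁ : IsSelfAdjoint B₁) (hB₂ : IsSelfAdjoint B₂)
    (Λ₀ c₁ : ℝ) (hΛ₀ : Λ₀ = sInf (spectrum ℝ A))
    (ψ₀ : H) (hψ₀ : ‖ψ₀‖ = 1) (heig : A ψ₀ = Λ₀ • ψ₀)
    (hker : ∀ u : H, A u = Λ₀ • u → ∃ c : ℂ, u = c • ψ₀)
    (hc₁ : 0 < c₁) (hgap : spectrum ℝ A ∩ Set.Ioo Λ₀ (Λ₀ + c₁) = ∅)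
    (Λ₁ Λ₂ : ℝ) (hΛ₁ : (Λ₁ : ℂ) = ⟪B₁ ψ₀, ψ₀⟫)
    (ψ₁ : H) (horth : ⟪ψ₀, ψ₁⟫ = 0)
    (hψ₁ : A ψ₁ - Λ₀ • ψ₁ = -(B₁ ψ₀) + Λ₁ • ψ₀)
    (hΛ₂ : (Λ₂ : ℂ) = ⟪B₁ ψ₁, ψ₀⟫ + ⟪B₂ ψ₀, ψ₀⟫)
    (t₀ : ℝ) (ht₀ : 0 < t₀) (B₃ : ℝ → H →L[ℂ] H)
    (hB₃sa : ∀ t ∈ Set.Icc (-t₀) t₀, IsSelfAdjoint (B₃ t))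
    (hB₃cont : ContinuousOn B₃ (Set.Icc (-t₀) t₀)) :
    ∃ C : ℝ, 0 ≤ C ∧ ∃ t₁ ∈ Set.Ioc (0 : ℝ) t₀, ∀ t : ℝ, |t| ≤ t₁ →
      |sInf (spectrum ℝ (A + t • B₁ + t ^ 2 • B₂ + t ^ 3 • B₃ t))
        - (Λ₀ + t * Λ₁ + t ^ 2 * Λ₂)| ≤ C * |t| ^ 3 := by
  obtain ⟨K, hK⟩ := isCompact_Icc.exists_bound_of_continuousOn hB₃cont
  have hK0 : 0 ≤ K := (norm_nonneg _).trans (hK 0 ⟨by linarith, ht₀.le⟩)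
  have hψψ : ⟪ψ₀, ψ₀⟫ = 1 := by simp [inner_self_eq_norm_sq_to_K, hψ₀]
  have hgap' : ∀ v : H, ⟪ψ₀, v⟫ = 0 → c₁ * ‖v‖ ^ 2 ≤ (⟪A v - Λ₀ • v, v⟫).re := by
    intro v hv
    have hsub : ∀ u, (A - algebraMap ℝ (H →L[ℂ] H) Λ₀) u = A u - Λ₀ • u := fun u => by
      simp [Algebra.algebraMap_eq_smul_one]
    rw [← hsub]
    refine (hA.sub (IsSelfAdjoint.all Λ₀ |>.algebraMap _)).gap_mul_norm_sq_le_re_inner ?_ ?_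
    · intro x hx
      rw [← spectrum.sub_singleton_eq, Set.sub_singleton] at hx
      obtain ⟨y, hy, rfl⟩ := hx
      have hle : Λ₀ ≤ y := hΛ₀ ▸ csInf_le (spectrum.isCompact A).bddBelow hy
      by_contra! hcon
      have : y ∈ spectrum ℝ A ∩ Set.Ioo Λ₀ (Λ₀ + c₁) :=
        ⟨hy, lt_of_le_of_ne hle fun h => hcon.1 (by simp [h]), by linarith [hcon.2]⟩
      simp [hgap] at this
    · rw [Submodule.mem_orthogonal]
      intro u hu
      obtain ⟨c, rfl⟩ := hker u (sub_eq_zero.1 ((hsub u).symm.trans hu))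
      rw [inner_smul_left, hv, mul_zero]
  set η : H := B₁ ψ₁ + B₂ ψ₀ - Λ₁ • ψ₁ - Λ₂ • ψ₀ with hη
  have hηψ : ⟪η, ψ₀⟫ = 0 := by
    have h : ⟪ψ₁, ψ₀⟫ = 0 := by rw [← inner_conj_symm, horth, map_zero]
    rw [hη, inner_sub_left, inner_sub_left, inner_add_left, inner_smul_left_eq_smul,
      inner_smul_left_eq_smul, h, hψψ, ← hΛ₂]
    simp
  set M : ℝ := ‖B₁‖ + ‖B₂‖ + K + |Λ₁| + |Λ₂| with hM
  have hM0 : 0 ≤ M := by positivity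
  set L : ℝ := K * (1 + ‖ψ₁‖) + ‖B₂ ψ₁‖ + |Λ₂| * ‖ψ₁‖ with hL
  have hL0 : 0 ≤ L := by positivity
  set κ : ℝ := ‖η‖ * ‖ψ₁‖ + L * (1 + ‖ψ₁‖) with hκ
  refine ⟨κ + (‖η‖ + L) ^ 2 / (c₁ / 2), by positivity,
    min (min t₀ 1) (c₁ / (2 * (M + 1))), ⟨by positivity, (min_le_left _ _).trans (min_le_left _ _)⟩,
    fun t ht => ?_⟩
  obtain ⟨⟨htt₀, ht1⟩, htM⟩ : (|t| ≤ t₀ ∧ |t| ≤ 1) ∧ |t| ≤ c₁ / (2 * (M + 1)) := by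
    simpa only [le_min_iff] using ht
  have htI : t ∈ Set.Icc (-t₀) t₀ := abs_le.1 htt₀
  have hBt := hK t htI
  set T : H →L[ℂ] H := A + t • B₁ + t ^ 2 • B₂ + t ^ 3 • B₃ t with hT
  set μ : ℝ := Λ₀ + t * Λ₁ + t ^ 2 * Λ₂ with hμ
  have hTsa : IsSelfAdjoint T :=
    ((hA.add ((IsSelfAdjoint.all t).smul hB₁)).add ((IsSelfAdjoint.all (t ^ 2)).smul hB₂)).add
      ((IsSelfAdjoint.all (t ^ 3)).smul (hB₃sa t htI))
  have hTapp : ∀ u, T u = A u + t • B₁ u + t ^ 2 • B₂ u + t ^ 3 • B₃ t u := fun u => rfl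
  have ht2 : |t| ^ 2 ≤ 1 := pow_le_one₀ (abs_nonneg _) ht1
  have hcoer : ∀ v : H, ⟪ψ₀, v⟫ = 0 → c₁ / 2 * ‖v‖ ^ 2 ≤ (⟪T v - μ • v, v⟫).re := by
    intro v hv
    set w : H := B₁ v + t • B₂ v + t ^ 2 • B₃ t v - Λ₁ • v - (t * Λ₂) • v with hw
    have hsplit : T v - μ • v = (A v - Λ₀ • v) + t • w := by
      rw [hTapp, hμ, hw]; module
    have hwn : ‖w‖ ≤ M * ‖v‖ := by
      calc ‖w‖ ≤ ‖B₁ v‖ + ‖t • B₂ v‖ + ‖t ^ 2 • B₃ t v‖ + ‖Λ₁ • v‖ + ‖(t * Λ₂) • v‖ :=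
            (norm_sub_le _ _).trans <| add_le_add_left ((norm_sub_le _ _).trans <|
              add_le_add_left norm_add₃_le _) _
        _ = ‖B₁ v‖ + |t| * ‖B₂ v‖ + |t| ^ 2 * ‖B₃ t v‖ + |Λ₁| * ‖v‖ + |t| * |Λ₂| * ‖v‖ := by
            simp only [norm_smul, Real.norm_eq_abs, abs_mul, abs_pow]
        _ ≤ ‖B₁‖ * ‖v‖ + 1 * (‖B₂‖ * ‖v‖) + 1 * (K * ‖v‖) + |Λ₁| * ‖v‖ + 1 * |Λ₂| * ‖v‖ := by
            gcongr
            · exact B₁.le_opNorm v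
            · exact B₂.le_opNorm v
            · exact (B₃ t).le_of_opNorm_le hBt v
        _ = M * ‖v‖ := by rw [hM]; ring
    have hcross : |(⟪t • w, v⟫).re| ≤ |t| * M * ‖v‖ ^ 2 := by
      refine (Complex.abs_re_le_norm _).trans ((norm_inner_le_norm _ _).trans ?_)
      rw [norm_smul, Real.norm_eq_abs]
      calc |t| * ‖w‖ * ‖v‖ ≤ |t| * (M * ‖v‖) * ‖v‖ := by gcongr
        _ = |t| * M * ‖v‖ ^ 2 := by ring
    have htM' : |t| * M ≤ c₁ / 2 := by
      rw [le_div_iff₀ (by positivity)] at htM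
      nlinarith [abs_nonneg t]
    rw [hsplit, inner_add_left, Complex.add_re]
    nlinarith [hgap' v hv, (abs_le.1 hcross).1, sq_nonneg ‖v‖]
  set φ : H := ψ₀ + t • ψ₁ with hφ
  have hφn : ‖φ‖ ≤ 1 + ‖ψ₁‖ := by
    refine (norm_add_le _ _).trans ?_
    rw [hψ₀, norm_smul, Real.norm_eq_abs]
    nlinarith [norm_nonneg ψ₁]
  have hφψ : ⟪ψ₀, φ⟫ = 1 := by
    rw [hφ, inner_add_right, inner_smul_right_eq_smul, horth, hψψ, smul_zero, add_zero]
  set R : H := B₃ t φ + B₂ ψ₁ - Λ₂ • ψ₁ with hR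
  have hRn : ‖R‖ ≤ L := by
    refine (norm_sub_le _ _).trans (add_le_add ((norm_add_le _ _).trans ?_) ?_)
    · gcongr
      exact ((B₃ t).le_of_opNorm_le hBt φ).trans (by gcongr)
    · rw [norm_smul, Real.norm_eq_abs]
  have hres : T φ - μ • φ = t ^ 2 • η + t ^ 3 • R := by
    have h1 : A ψ₁ = Λ₀ • ψ₁ + (-(B₁ ψ₀) + Λ₁ • ψ₀) := by rw [← hψ₁]; abel
    have hreal : ∀ B : H →L[ℂ] H, B φ = B ψ₀ + t • B ψ₁ := fun B => by
      rw [hφ, map_add, ContinuousLinearMap.map_smul_of_tower]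
    rw [hTapp, hR, hη, hμ, hreal A, hreal B₁, hreal B₂, heig, h1, hφ]
    module
  have hresn : ‖T φ - μ • φ‖ ≤ |t| ^ 2 * (‖η‖ + L) := by
    rw [hres]
    refine (norm_add_le _ _).trans ?_
    rw [norm_smul, norm_smul, norm_pow, norm_pow, Real.norm_eq_abs, mul_add]
    exact add_le_add le_rfl (mul_le_mul (pow_le_pow_of_le_one (abs_nonneg _) ht1 (by norm_num))
      hRn (norm_nonneg _) (by positivity))
  have hform : |(⟪T φ - μ • φ, φ⟫).re| ≤ |t| ^ 3 * κ := by
    have h : ⟪T φ - μ • φ, φ⟫ = t ^ 3 • (⟪η, ψ₁⟫ + ⟪R, φ⟫) := by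
      have h1 : ⟪η, φ⟫ = t • ⟪η, ψ₁⟫ := by
        rw [hφ, inner_add_right, hηψ, zero_add, inner_smul_right_eq_smul]
      rw [hres, inner_add_left, inner_smul_left_eq_smul, inner_smul_left_eq_smul, h1]
      module
    rw [h]
    refine (Complex.abs_re_le_norm _).trans ?_
    rw [norm_smul, norm_pow, Real.norm_eq_abs]
    gcongr
    refine (norm_add_le _ _).trans (add_le_add (norm_inner_le_norm _ _) ?_)
    exact (norm_inner_le_norm _ _).trans (by gcongr)
  refine (hTsa.abs_sInf_spectrum_sub_le hψ₀ hφψ (half_pos hc₁) hcoer hresn hform).trans ?_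
  have h4 : |t| ^ 4 ≤ |t| ^ 3 := pow_le_pow_of_le_one (abs_nonneg _) ht1 (by norm_num)
  calc |t| ^ 3 * κ + (|t| ^ 2 * (‖η‖ + L)) ^ 2 / (c₁ / 2)
      = |t| ^ 3 * κ + |t| ^ 4 * ((‖η‖ + L) ^ 2 / (c₁ / 2)) := by ring
    _ ≤ |t| ^ 3 * κ + |t| ^ 3 * ((‖η‖ + L) ^ 2 / (c₁ / 2)) := by gcongr
    _ = (κ + (‖η‖ + L) ^ 2 / (c₁ / 2)) * |t| ^ 3 := by ring
end

section
/- Assume: H is a complex Hilbert space; A : H → H is a bounded self-adjoint operator; Λ₀ := inf spec(A); Λ₀ is an eigenvalue of A with unit eigenvector ψ₀; ker(A − Λ₀ I) = ℂ·ψ₀; and for some constant c₁ > 0 the spectral gap condition spec(A) ∩ (Λ₀, Λ₀ + c₁) = ∅ holds. Let B₁, B₂ be bounded self-adjoint operators on H, Λ₁ := ⟨B₁ψ₀, ψ₀⟩, let ψ₁ be the unique vector orthogonal to ψ₀ with (A − Λ₀ I)ψ₁ = −B₁ψ₀ + Λ₁ψ₀, and Λ₂ := ⟨B₁ψ₁,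 ψ₀⟩ + ⟨B₂ψ₀, ψ₀⟩. If Λ₁ = 0 and B₂ is non-positive (⟨B₂u, u⟩ ≤ 0 for all u ∈ H), then Λ₂ ≤ −c₁‖ψ₁‖². -/
open scoped ComplexInnerProductSpace

/-- If the spectrum of a self-adjoint operator `A` lies in `[Λ, ∞)` and avoids `(Λ, Λ + c)`, then
`A - Λ` is bounded below by `c` on the orthogonal complement of `ker (A - Λ)`. -/
theorem ContinuousLinearMap.gap_mul_norm_sq_le_re_inner
    {H : Type*} [NormedAddCommGroup H] [InnerProductSpace ℂ H] [CompleteSpace H]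
    {A : H →L[ℂ] H} (hA : IsSelfAdjoint A) {Λ c : ℝ}
    (hspec : ∀ x ∈ spectrum ℝ A, x = Λ ∨ Λ + c ≤ x)
    {u : H} (hu : ∀ v : H, A v = Λ • v → ⟪v, u⟫ = 0) :
    c * ‖u‖ ^ 2 ≤ (⟪A u - Λ • u, u⟫).re := by
  let g : ℝ → ℝ := fun x => max 0 (c - (x - Λ))
  have hg : Continuous g := by fun_prop
  have hsub : cfc (fun x : ℝ => x - Λ) A = A - algebraMap ℝ (H →L[ℂ] H) Λ := by
    rw [cfc_sub (fun x : ℝ => x) (fun _ => Λ) A, cfc_id' ℝ A, cfc_const Λ A]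
  have hmul : (A - algebraMap ℝ (H →L[ℂ] H) Λ) * cfc g A = 0 := by
    rw [← hsub, ← cfc_mul (fun x : ℝ => x - Λ) g A (by fun_prop) hg.continuousOn,
      ← cfc_zero ℝ A]
    refine cfc_congr fun x hx => ?_
    rcases hspec x hx with rfl | h
    · simp
    · simp [g, max_eq_left (show c - (x - Λ) ≤ 0 by linarith)]
  have hpos : 0 ≤ A - algebraMap ℝ (H →L[ℂ] H) Λ + cfc g A - algebraMap ℝ (H →L[ℂ] H) c := by
    rw [← hsub, ← cfc_add A (fun x : ℝ => x - Λ) g (by fun_prop) hg.continuousOn,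
      ← cfc_const c A, ← cfc_sub _ _ A (by fun_prop) (by fun_prop)]
    refine cfc_nonneg fun x _ => ?_
    have := le_max_right 0 (c - (x - Λ))
    simp only [g]
    linarith
  have hortho : ⟪cfc g A u, u⟫ = 0 := hu _ <| sub_eq_zero.mp <| by
    simpa [Algebra.algebraMap_eq_smul_one] using DFunLike.congr_fun hmul u
  have h := ((ContinuousLinearMap.nonneg_iff_isPositive _).mp hpos).re_inner_nonneg_left u
  have hc : (⟪c • u, u⟫).re = c * ‖u‖ ^ 2 := by
    rw [← Complex.coe_smul, inner_smul_left, Complex.conj_ofReal, Complex.re_ofReal_mul,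
      inner_self_eq_norm_sq_to_K]
    norm_cast
  simp only [Algebra.algebraMap_eq_smul_one, sub_apply,
    add_apply, smul_apply,
    one_apply_eq_self] at h
  rw [inner_sub_left, inner_add_left, hortho, add_zero] at h
  simp only [map_sub, RCLike.re_to_complex, hc] at h
  linarith

theorem lambda2_le_neg_gap_of_lambda1_eq_zero
    {H : Type*} [NormedAddCommGroup H] [InnerProductSpace ℂ H] [CompleteSpace H]
    (A B₁ B₂ : H →L[ℂ] H)
    (hA : IsSelfAdjoint A) (hB₁ : IsSelfAdjoint B₁) (hB₂ : IsSelfAdjoint B₂)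
    (Λ₀ c₁ : ℝ) (hΛ₀ : Λ₀ = sInf (spectrum ℝ A))
    (ψ₀ : H) (hψ₀ : ‖ψ₀‖ = 1) (heig : A ψ₀ = Λ₀ • ψ₀)
    (hker : ∀ u : H, A u = Λ₀ • u → ∃ c : ℂ, u = c • ψ₀)
    (hc₁ : 0 < c₁) (hgap : spectrum ℝ A ∩ Set.Ioo Λ₀ (Λ₀ + c₁) = ∅)
    (Λ₁ Λ₂ : ℝ) (hΛ₁ : (Λ₁ : ℂ) = ⟪B₁ ψ₀, ψ₀⟫)
    (ψ₁ : H) (horth : ⟪ψ₀, ψ₁⟫ = 0)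
    (hψ₁ : A ψ₁ - Λ₀ • ψ₁ = -(B₁ ψ₀) + Λ₁ • ψ₀)
    (hΛ₂ : (Λ₂ : ℂ) = ⟪B₁ ψ₁, ψ₀⟫ + ⟪B₂ ψ₀, ψ₀⟫)
    (hΛ₁zero : Λ₁ = 0)
    (hB₂nonpos : ∀ u : H, (⟪B₂ u, u⟫).re ≤ 0) :
    Λ₂ ≤ -c₁ * ‖ψ₁‖ ^ 2 := by
  subst hΛ₁zero
  have hspec : ∀ x ∈ spectrum ℝ A, x = Λ₀ ∨ Λ₀ + c₁ ≤ x := by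
    intro x hx
    have hle : Λ₀ ≤ x := hΛ₀ ▸ csInf_le (spectrum.isCompact A).bddBelow hx
    by_contra! h
    exact (hgap ▸ ⟨hx, lt_of_le_of_ne hle h.1.symm, h.2⟩ : x ∈ (∅ : Set ℝ))
  have hψ₁_ortho : ∀ v : H, A v = Λ₀ • v → ⟪v, ψ₁⟫ = 0 := by
    intro v hv
    obtain ⟨a, rfl⟩ := hker v hv
    rw [inner_smul_left, horth, mul_zero]
  have hbound := A.gap_mul_norm_sq_le_re_inner hA hspec hψ₁_ortho
  rw [hψ₁, zero_smul, add_zero, inner_neg_left, Complex.neg_re] at hbound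
  have hsymm : (⟪B₁ ψ₁, ψ₀⟫).re = (⟪B₁ ψ₀, ψ₁⟫).re := by
    rw [show ⟪B₁ ψ₁, ψ₀⟫ = ⟪ψ₁, B₁ ψ₀⟫ from hB₁.isSymmetric ψ₁ ψ₀]
    exact inner_re_symm (𝕜 := ℂ) ψ₁ (B₁ ψ₀)
  have hre := congrArg Complex.re hΛ₂
  rw [Complex.ofReal_re, Complex.add_re, hsymm] at hre
  linarith [hB₂nonpos ψ₀]
end
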